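/- Let K be an infinite field, n ≥ 2 and m ≥ 1 integers, and p(x_1,...,x_m) a noncommutative polynomial with zero constant term over K of order r with 1 < r < n − 1. Then p(T_n(K)) + p(T_n(K)) = T_n(K)^{(r−1)}, i.e., every n × n upper triangular matrix whose (i,j) entries vanish for j − i ≤ r − 1 is a sum of two elements from the image of p on T_n(K). -/

import Mathlib

/-- `A` is upper triangular. -/
def UT {K : Type*} [Field K] {n : ℕ} (A : Matrix (Fin n) (Fin n) K) : Prop :=
  ∀ i j : Fin n, (j : ℕ) < (i : ℕ) → A i j = 0

/-- `p` has zero constant term. -/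
def ZeroConst {K : Type*} [Field K] {m : ℕ} (p : FreeAlgebra K (Fin m)) : Prop :=
  FreeAlgebra.lift K (fun _ : Fin m => (0 : K)) p = 0

/-- `p` has order `r`: it vanishes on all upper triangular `r × r` matrices but not on
all upper triangular `(r+1) × (r+1)` matrices. -/
def HasOrder {K : Type*} [Field K] {m : ℕ} (p : FreeAlgebra K (Fin m)) (r : ℕ) : Prop :=
  (∀ u : Fin m → Matrix (Fin r) (Fin r) K, (∀ i, UT (u i)) →
      FreeAlgebra.lift K u p = 0) ∧
  ∃ u : Fin m → Matrix (Fin (r + 1)) (Fin (r + 1)) K, (∀ i, UT (u i)) ∧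
      FreeAlgebra.lift K u p ≠ 0

theorem UT.mul {K : Type*} [Field K] {n : ℕ} {A B : Matrix (Fin n) (Fin n) K}
    (hA : UT A) (hB : UT B) : UT (A * B) := by
  intro i j hij
  rw [Matrix.mul_apply]
  refine Finset.sum_eq_zero fun k _ => ?_
  by_cases hk : (k : ℕ) < i
  · rw [hA i k hk, zero_mul]
  · rw [hB k j (by omega), mul_zero]

theorem UT.lift {K : Type*} [Field K] {m n : ℕ} {u : Fin m → Matrix (Fin n) (Fin n) K}
    (hu : ∀ l, UT (u l)) (p : FreeAlgebra K (Fin m)) : UT (FreeAlgebra.lift K u p) := by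
  induction p using FreeAlgebra.induction with
  | grade0 c =>
    intro i j hij
    rw [AlgHom.commutes, Matrix.algebraMap_matrix_apply, if_neg]
    rintro rfl
    exact lt_irrefl _ hij
  | grade1 l => simpa using hu l
  | add a b ha hb =>
    intro i j hij
    rw [map_add, Matrix.add_apply, ha i j hij, hb i j hij, add_zero]
  | mul a b ha hb =>
    rw [map_mul]
    exact ha.mul hb

/-- The inclusion of `Fin k` in `Fin n` as the interval of length `k` starting at `s`. -/
def intervalEmb {k n : ℕ} (s : ℕ) (h : s + k ≤ n) (a : Fin k) : Fin n := ⟨s + a, by omega⟩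

theorem UT.submatrix_mul {K : Type*} [Field K] {k n s : ℕ} (h : s + k ≤ n)
    {A B : Matrix (Fin n) (Fin n) K} (hA : UT A) (hB : UT B) :
    (A * B).submatrix (intervalEmb s h) (intervalEmb s h) =
      A.submatrix (intervalEmb s h) (intervalEmb s h) *
        B.submatrix (intervalEmb s h) (intervalEmb s h) := by
  ext a b
  simp only [Matrix.submatrix_apply, Matrix.mul_apply]
  have hinj : Function.Injective (intervalEmb s h) := fun x y hxy => by
    simp only [intervalEmb, Fin.mk.injEq] at hxy
    omega
  refine (Fintype.sum_of_injective _ hinj _ _ (fun c hc => ?_) fun _ => rfl).symm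
  by_cases h1 : (c : ℕ) < s + a
  · rw [hA _ _ (by simpa [intervalEmb] using h1), zero_mul]
  · rw [hB, mul_zero]
    by_contra h2
    simp only [intervalEmb] at h2
    exact hc ⟨⟨c - s, by omega⟩, Fin.ext (by simp only [intervalEmb]; omega)⟩

theorem UT.submatrix {K : Type*} [Field K] {k n s : ℕ} (h : s + k ≤ n)
    {A : Matrix (Fin n) (Fin n) K} (hA : UT A) :
    UT (A.submatrix (intervalEmb s h) (intervalEmb s h)) := fun i j hij =>
  hA _ _ (by simpa [intervalEmb] using hij)

theorem lift_submatrix {K : Type*} [Field K] {m k n s : ℕ} (h : s + k ≤ n)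
    {u : Fin m → Matrix (Fin n) (Fin n) K} (hu : ∀ l, UT (u l)) (p : FreeAlgebra K (Fin m)) :
    (FreeAlgebra.lift K u p).submatrix (intervalEmb s h) (intervalEmb s h) =
      FreeAlgebra.lift K
        (fun l => (u l).submatrix (intervalEmb s h) (intervalEmb s h)) p := by
  induction p using FreeAlgebra.induction with
  | grade0 c =>
    ext a b
    simp only [AlgHom.commutes, Matrix.submatrix_apply, Matrix.algebraMap_matrix_apply,
      intervalEmb, Nat.add_left_cancel_iff, Fin.ext_iff]
  | grade1 l => simp
  | add a b ha hb => rw [map_add, map_add, ← ha, ← hb, Matrix.submatrix_add]; rfl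
  | mul a b ha hb =>
    rw [map_mul, map_mul, ← ha, ← hb, UT.submatrix_mul h (UT.lift hu a) (UT.lift hu b)]

/-- If `p` vanishes on upper triangular `r × r` matrices, its values on upper triangular
`n × n` matrices lie in the `r`-th power of the radical. -/
theorem lift_apply_eq_zero {K : Type*} [Field K] {m n r : ℕ} {p : FreeAlgebra K (Fin m)}
    (hp : ∀ u : Fin m → Matrix (Fin r) (Fin r) K, (∀ i, UT (u i)) → FreeAlgebra.lift K u p = 0)
    (hrn : r ≤ n) {u : Fin m → Matrix (Fin n) (Fin n) K} (hu : ∀ l, UT (u l))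
    (i j : Fin n) (hij : (j : ℕ) < i + r) : FreeAlgebra.lift K u p i j = 0 := by
  by_cases hlt : (j : ℕ) < i
  · exact UT.lift hu p i j hlt
  have h : min (i : ℕ) (n - r) + r ≤ n := by omega
  have key := lift_submatrix h hu p
  rw [hp _ fun l => (hu l).submatrix h] at key
  obtain ⟨a, ha⟩ : ∃ a, intervalEmb _ h a = i :=
    ⟨⟨i - min (i : ℕ) (n - r), by omega⟩, Fin.ext (by simp only [intervalEmb]; omega)⟩
  obtain ⟨b, hb⟩ : ∃ b, intervalEmb _ h b = j :=
    ⟨⟨j - min (i : ℕ) (n - r), by omega⟩, Fin.ext (by simp only [intervalEmb]; omega)⟩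
  have hab := congrFun (congrFun key a) b
  rwa [Matrix.submatrix_apply, ha, hb, Matrix.zero_apply] at hab

/-- A polynomial of order `r` takes a value all of whose entries on the `r`-th
superdiagonal are nonzero. -/
theorem exists_lift_superdiagonal_ne_zero {K : Type*} [Field K] [Infinite K] {m n r : ℕ}
    {p : FreeAlgebra K (Fin m)} (hord : HasOrder p r) :
    ∃ u : Fin m → Matrix (Fin n) (Fin n) K, (∀ l, UT (u l)) ∧
      ∀ i j : Fin n, (j : ℕ) = i + r → FreeAlgebra.lift K u p i j ≠ 0 := by
  obtain ⟨hp, w, hw, hne⟩ := hord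
  have hw0 : FreeAlgebra.lift K w p 0 (Fin.last r) ≠ 0 := by
    intro h0
    refine hne (Matrix.ext fun i j => ?_)
    by_cases hij : (j : ℕ) < i + r
    · exact lift_apply_eq_zero hp (Nat.le_succ r) hw i j hij
    · have hi : i = 0 := Fin.ext (by simp only [Fin.val_zero]; omega)
      have hj : j = Fin.last r := Fin.ext (by simp only [Fin.val_last]; omega)
      rw [hi, hj, h0, Matrix.zero_apply]
  let U : Fin m → Matrix (Fin n) (Fin n) (MvPolynomial (Fin m × Fin n × Fin n) K) :=
    fun l => Matrix.of fun i j => if (j : ℕ) < i then 0 else MvPolynomial.X (l, i, j)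
  let V : (Fin m × Fin n × Fin n → K) → Fin m → Matrix (Fin n) (Fin n) K :=
    fun e l => Matrix.of fun i j => if (j : ℕ) < i then 0 else e (l, i, j)
  have hV : ∀ e l, UT (V e l) := fun e l i j hij => if_pos hij
  have heval : ∀ e i j, MvPolynomial.aeval e (FreeAlgebra.lift K U p i j) =
      FreeAlgebra.lift K (V e) p i j := by
    intro e i j
    have : ((MvPolynomial.aeval e).mapMatrix).comp (FreeAlgebra.lift K U) =
        FreeAlgebra.lift K (V e) := by
      ext l a b
      by_cases hab : (b : ℕ) < a <;> simp [U, V, hab, -Fin.val_fin_lt]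
    rw [← this]
    rfl
  have hU : ∀ i j : Fin n, (j : ℕ) = i + r → FreeAlgebra.lift K U p i j ≠ 0 := by
    intro i j hij h0
    have h : (i : ℕ) + (r + 1) ≤ n := by omega
    let e : Fin m × Fin n × Fin n → K := fun x =>
      if hx : (x.2.1 : ℕ) - i < r + 1 ∧ (x.2.2 : ℕ) - i < r + 1 then
        w x.1 ⟨_, hx.1⟩ ⟨_, hx.2⟩ else 0
    have hsub : (fun l => (V e l).submatrix (intervalEmb i h) (intervalEmb i h)) = w := by
      funext l
      ext a b
      by_cases hab : (b : ℕ) < a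
      · simp [V, intervalEmb, hab, hw l a b hab, -Fin.val_fin_lt]
      · simp only [V, e, intervalEmb, Matrix.submatrix_apply, Matrix.of_apply,
          Nat.add_lt_add_iff_left, hab, if_false, Nat.add_sub_cancel_left, a.2, b.2, and_self,
          dite_true, Fin.eta]
    have key := lift_submatrix h (hV e) p
    rw [hsub] at key
    apply hw0
    rw [← key, Matrix.submatrix_apply]
    have hi : intervalEmb i h 0 = i := Fin.ext (by simp [intervalEmb])
    have hj : intervalEmb i h (Fin.last r) = j := Fin.ext (by simp [intervalEmb, hij])
    rw [hi, hj, ← heval, h0, map_zero]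
  let P : MvPolynomial (Fin m × Fin n × Fin n) K :=
    ∏ x ∈ Finset.univ.filter (fun x : Fin n × Fin n => (x.2 : ℕ) = x.1 + r),
      FreeAlgebra.lift K U p x.1 x.2
  have hP : P ≠ 0 := Finset.prod_ne_zero_iff.2 fun x hx =>
    hU x.1 x.2 (Finset.mem_filter.1 hx).2
  obtain ⟨e, he⟩ : ∃ e, MvPolynomial.eval e P ≠ 0 := by
    by_contra! hall
    exact hP (MvPolynomial.funext fun e => by rw [hall e, map_zero])
  refine ⟨V e, hV e, fun i j hij => ?_⟩
  rw [map_prod, Finset.prod_ne_zero_iff] at he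
  rw [← heval]
  simpa [MvPolynomial.aeval_eq_eval] using he (i, j) (by simpa using hij)

/-- An upper triangular solution `g` of `g * M = A * g`, where `A` and `M` have their lowest
nonzero superdiagonal in position `r`. -/
noncomputable def superdiagonalIntertwiner {K : Type*} [Field K] (r n : ℕ) (A M : ℕ → ℕ → K)
    (i j : ℕ) : K :=
  if j < i then 0
  else if j + r < n then
    (∑ k ∈ (Finset.Ico (i + 1) n).attach, A i k * superdiagonalIntertwiner r n A M k (j + r) -
      ∑ k ∈ (Finset.Ico i j).attach, superdiagonalIntertwiner r n A M i k * M k (j + r)) /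
        M j (j + r)
  else if i = j then 1 else 0
termination_by (n - i, j)
decreasing_by
  · have := Finset.mem_Ico.1 k.2
    exact Prod.Lex.left _ _ (by omega)
  · have := Finset.mem_Ico.1 k.2
    exact Prod.Lex.right _ (by omega)

section Intertwiner

variable {K : Type*} [Field K] {r n : ℕ} {A M : ℕ → ℕ → K}

theorem superdiagonalIntertwiner_of_lt {i j : ℕ} (h : j < i) :
    superdiagonalIntertwiner r n A M i j = 0 := by
  rw [superdiagonalIntertwiner, if_pos h]

theorem superdiagonalIntertwiner_mul {i j : ℕ} (hij : i ≤ j) (hj : j + r < n)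
    (hM : M j (j + r) ≠ 0) :
    superdiagonalIntertwiner r n A M i j * M j (j + r) =
      ∑ k ∈ Finset.Ico (i + 1) n, A i k * superdiagonalIntertwiner r n A M k (j + r) -
        ∑ k ∈ Finset.Ico i j, superdiagonalIntertwiner r n A M i k * M k (j + r) := by
  rw [superdiagonalIntertwiner, if_neg (by omega), if_pos hj, div_mul_cancel₀ _ hM,
    Finset.sum_attach (Finset.Ico (i + 1) n)
      (fun k => A i k * superdiagonalIntertwiner r n A M k (j + r)),
    Finset.sum_attach (Finset.Ico i j)
      (fun k => superdiagonalIntertwiner r n A M i k * M k (j + r))]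

theorem superdiagonalIntertwiner_self_ne_zero (hr : 0 < r)
    (hA : ∀ i j, j < i + r → A i j = 0) (hA' : ∀ i, i + r < n → A i (i + r) ≠ 0)
    (hM' : ∀ i, i + r < n → M i (i + r) ≠ 0) (i : ℕ) :
    superdiagonalIntertwiner r n A M i i ≠ 0 := by
  induction hd : n - i using Nat.strong_induction_on generalizing i with
  | _ d ih =>
    by_cases hi : i + r < n
    · have h := superdiagonalIntertwiner_mul (A := A) le_rfl hi (hM' i hi)
      rw [Finset.Ico_self, Finset.sum_empty, sub_zero,
        Finset.sum_eq_single_of_mem (i + r) (Finset.mem_Ico.2 ⟨by omega, hi⟩)] at h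
      · intro h0
        rw [h0, zero_mul] at h
        exact mul_ne_zero (hA' i hi) (ih _ (by omega) (i + r) rfl) h.symm
      · intro k _ hk
        rcases lt_or_gt_of_ne hk with hk | hk
        · rw [hA i k hk, zero_mul]
        · rw [superdiagonalIntertwiner_of_lt hk, mul_zero]
    · rw [superdiagonalIntertwiner, if_neg (lt_irrefl i), if_neg hi, if_pos rfl]
      exact one_ne_zero

theorem sum_superdiagonalIntertwiner_mul (hr : 0 < r)
    (hA : ∀ i j, j < i + r → A i j = 0) (hM : ∀ i j, j < i + r → M i j = 0)
    (hM' : ∀ i, i + r < n → M i (i + r) ≠ 0) {i j : ℕ} (hj : j < n) :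
    ∑ k ∈ Finset.range n, superdiagonalIntertwiner r n A M i k * M k j =
      ∑ k ∈ Finset.range n, A i k * superdiagonalIntertwiner r n A M k j := by
  by_cases hij : j < i + r
  · rw [Finset.sum_eq_zero, Finset.sum_eq_zero]
    · intro k _
      by_cases hk : k < i + r
      · rw [hA i k hk, zero_mul]
      · rw [superdiagonalIntertwiner_of_lt (by omega), mul_zero]
    · intro k _
      by_cases hk : k < i
      · rw [superdiagonalIntertwiner_of_lt hk, zero_mul]
      · rw [hM k j (by omega), mul_zero]
  obtain ⟨l, rfl⟩ : ∃ l, j = l + r := ⟨j - r, by omega⟩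
  have h := superdiagonalIntertwiner_mul (A := A) (i := i) (by omega) hj (hM' l hj)
  have h1 : ∑ k ∈ Finset.range n, superdiagonalIntertwiner r n A M i k * M k (l + r) =
      ∑ k ∈ Finset.Ico i (l + 1), superdiagonalIntertwiner r n A M i k * M k (l + r) := by
    symm
    refine Finset.sum_subset (fun k hk => ?_) fun k _ hk => ?_
    · rw [Finset.mem_Ico] at hk
      exact Finset.mem_range.2 (by omega)
    · rw [Finset.mem_Ico] at hk
      by_cases hki : k < i
      · rw [superdiagonalIntertwiner_of_lt hki, zero_mul]
      · rw [hM k _ (by omega), mul_zero]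
  have h2 : ∑ k ∈ Finset.range n, A i k * superdiagonalIntertwiner r n A M k (l + r) =
      ∑ k ∈ Finset.Ico (i + 1) n, A i k * superdiagonalIntertwiner r n A M k (l + r) := by
    symm
    refine Finset.sum_subset (fun k hk => ?_) fun k hkn hk => ?_
    · exact Finset.mem_range.2 (Finset.mem_Ico.1 hk).2
    · rw [Finset.mem_Ico] at hk
      rw [Finset.mem_range] at hkn
      rw [hA i k (by omega), zero_mul]
  rw [h1, h2, Finset.sum_Ico_succ_top (by omega), h]
  ring

end Intertwiner

/-- The extension by zero of a matrix to a function on pairs of natural numbers. -/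
def Matrix.extendNat {K : Type*} [Zero K] {n : ℕ} (A : Matrix (Fin n) (Fin n) K) (i j : ℕ) : K :=
  if h : i < n ∧ j < n then A ⟨i, h.1⟩ ⟨j, h.2⟩ else 0

theorem Matrix.extendNat_val {K : Type*} [Zero K] {n : ℕ} (A : Matrix (Fin n) (Fin n) K)
    (i j : Fin n) : A.extendNat i j = A i j := by
  simp [Matrix.extendNat]

theorem Matrix.extendNat_eq_zero {K : Type*} [Zero K] {n r : ℕ} {A : Matrix (Fin n) (Fin n) K}
    (hA : ∀ i j : Fin n, (j : ℕ) < i + r → A i j = 0) (i j : ℕ) (hij : j < i + r) :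
    A.extendNat i j = 0 := by
  unfold Matrix.extendNat
  split_ifs with h
  · exact hA _ _ hij
  · rfl

theorem Matrix.extendNat_ne_zero {K : Type*} [Zero K] {n r : ℕ} {A : Matrix (Fin n) (Fin n) K}
    (hA : ∀ i j : Fin n, (j : ℕ) = i + r → A i j ≠ 0) (i : ℕ) (hi : i + r < n) :
    A.extendNat i (i + r) ≠ 0 := by
  rw [Matrix.extendNat, dif_pos ⟨by omega, hi⟩]
  exact hA _ _ rfl

/-- Two matrices whose lowest nonzero superdiagonal is the `r`-th one, and is nowhere zero, are
conjugate under the group of invertible upper triangular matrices. -/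
theorem exists_UT_conj {K : Type*} [Field K] {n r : ℕ} (hr : 0 < r)
    {A M : Matrix (Fin n) (Fin n) K}
    (hA : ∀ i j : Fin n, (j : ℕ) < i + r → A i j = 0)
    (hA' : ∀ i j : Fin n, (j : ℕ) = i + r → A i j ≠ 0)
    (hM : ∀ i j : Fin n, (j : ℕ) < i + r → M i j = 0)
    (hM' : ∀ i j : Fin n, (j : ℕ) = i + r → M i j ≠ 0) :
    ∃ g : (Matrix (Fin n) (Fin n) K)ˣ, UT (g : Matrix (Fin n) (Fin n) K) ∧
      UT ((g⁻¹ : (Matrix (Fin n) (Fin n) K)ˣ) : Matrix (Fin n) (Fin n) K) ∧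
      (g : Matrix (Fin n) (Fin n) K) * M * (g⁻¹ : (Matrix (Fin n) (Fin n) K)ˣ) = A := by
  let g : Matrix (Fin n) (Fin n) K := fun i j =>
    superdiagonalIntertwiner r n A.extendNat M.extendNat i j
  have hg : g.BlockTriangular id := fun i j hij => superdiagonalIntertwiner_of_lt hij
  have hdet : IsUnit g.det := by
    rw [Matrix.det_of_isUpperTriangular hg, isUnit_iff_ne_zero]
    exact Finset.prod_ne_zero_iff.2 fun i _ => superdiagonalIntertwiner_self_ne_zero hr
      (Matrix.extendNat_eq_zero hA) (Matrix.extendNat_ne_zero hA')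
      (Matrix.extendNat_ne_zero hM') i
  have hcomm : g * M = A * g := by
    ext i j
    have h := sum_superdiagonalIntertwiner_mul (n := n) hr (Matrix.extendNat_eq_zero hA)
      (Matrix.extendNat_eq_zero hM) (Matrix.extendNat_ne_zero hM') (i := i) j.2
    rw [Finset.sum_range, Finset.sum_range] at h
    simp only [Matrix.extendNat_val] at h
    rw [Matrix.mul_apply, Matrix.mul_apply]
    exact h
  let _ := Matrix.invertibleOfIsUnitDet g hdet
  refine ⟨unitOfInvertible g, fun i j hij => hg hij, fun i j hij => ?_, ?_⟩
  · have hinv := Matrix.blockTriangular_inv_of_blockTriangular hg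
    rw [← Matrix.invOf_eq_nonsing_inv] at hinv
    exact hinv hij
  · change g * M * ⅟g = A
    rw [hcomm, mul_assoc, mul_invOf_self, mul_one]

theorem FreeAlgebra.lift_units_conj {K R X : Type*} [CommSemiring K] [Semiring R] [Algebra K R]
    (g : Rˣ) (u : X → R) (p : FreeAlgebra K X) :
    FreeAlgebra.lift K (fun l => (g : R) * u l * (g⁻¹ : Rˣ)) p =
      g * FreeAlgebra.lift K u p * (g⁻¹ : Rˣ) := by
  induction p using FreeAlgebra.induction with
  | grade0 c => simp [← Algebra.commutes, mul_assoc]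
  | grade1 l => simp
  | add a b ha hb => rw [map_add, map_add, ha, hb, mul_add, add_mul]
  | mul a b ha hb => rw [map_mul, map_mul, ha, hb]; simp [mul_assoc]

/-- Every matrix whose lowest nonzero superdiagonal is the `r`-th one, and is nowhere zero, is a
value of a polynomial of order `r`. -/
theorem exists_lift_eq_of_superdiagonal_ne_zero {K : Type*} [Field K] [Infinite K] {m n r : ℕ}
    {p : FreeAlgebra K (Fin m)} (hord : HasOrder p r) (hr : 0 < r) (hrn : r ≤ n)
    {A : Matrix (Fin n) (Fin n) K} (hA : ∀ i j : Fin n, (j : ℕ) < i + r → A i j = 0)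
    (hA' : ∀ i j : Fin n, (j : ℕ) = i + r → A i j ≠ 0) :
    ∃ u : Fin m → Matrix (Fin n) (Fin n) K, (∀ l, UT (u l)) ∧ FreeAlgebra.lift K u p = A := by
  obtain ⟨u, hu, hne⟩ := exists_lift_superdiagonal_ne_zero (n := n) hord
  obtain ⟨g, hg, hg', hconj⟩ :=
    exists_UT_conj hr hA hA' (lift_apply_eq_zero hord.1 hrn hu) hne
  exact ⟨_, fun l => (hg.mul (hu l)).mul hg', (FreeAlgebra.lift_units_conj g u p).trans hconj⟩

theorem stmt_9 {K : Type*} [Field K] [Infinite K] (m n r : ℕ) (hm : 1 ≤ m) (hn : 2 ≤ n)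
    (p : FreeAlgebra K (Fin m)) (hp : ZeroConst p)
    (hord : HasOrder p r) (hr1 : 1 < r) (hr2 : r + 1 < n) :
    ∀ A : Matrix (Fin n) (Fin n) K,
      (∀ i j : Fin n, (j : ℕ) < (i : ℕ) + r → A i j = 0) ↔
      ∃ u v : Fin m → Matrix (Fin n) (Fin n) K, (∀ i, UT (u i)) ∧ (∀ i, UT (v i)) ∧
        FreeAlgebra.lift K u p + FreeAlgebra.lift K v p = A := by
  classical
  intro A
  constructor
  · intro hA
    have hb : ∀ a : K, ∃ b : K, b ≠ 0 ∧ a - b ≠ 0 := fun a => by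
      obtain ⟨b, hb⟩ := Infinite.exists_notMem_finset ({0, a} : Finset K)
      simp only [Finset.mem_insert, Finset.mem_singleton, not_or] at hb
      exact ⟨b, hb.1, sub_ne_zero.2 (Ne.symm hb.2)⟩
    choose b hb0 hb1 using hb
    let B : Matrix (Fin n) (Fin n) K :=
      Matrix.of fun i j => if (j : ℕ) = i + r then b (A i j) else 0
    obtain ⟨u, hu, hpu⟩ := exists_lift_eq_of_superdiagonal_ne_zero hord (by omega) (by omega)
      (A := B) (fun i j hij => if_neg hij.ne) (fun i j hij => by simp [B, hij, hb0])
    obtain ⟨v, hv, hpv⟩ := exists_lift_eq_of_superdiagonal_ne_zero hord (by omega) (by omega)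
      (A := A - B) (fun i j hij => by simp [B, hij.ne, hA i j hij])
      (fun i j hij => by simpa [B, hij] using hb1 (A i j))
    exact ⟨u, v, hu, hv, by rw [hpu, hpv, add_sub_cancel]⟩
  · rintro ⟨u, v, hu, hv, rfl⟩ i j hij
    rw [Matrix.add_apply, lift_apply_eq_zero hord.1 (by omega) hu i j hij,
      lift_apply_eq_zero hord.1 (by omega) hv i j hij, add_zero]
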